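/- Let Ω0 be a p×p real symmetric positive definite matrix, Σ0 := Ω0⁻¹, and let U be a symmetric p×p real matrix. Let d_j := Σ_{k=1}^p |Ω0_{jk}|. Let (Σ̂_T)_{T∈ℕ} be a sequence of p×p real matrices and W a p×p real matrix such that √T·(Σ̂_T − Σ0) → W entrywise as T → ∞, and let (λ_T) be real numbers with √T·λ_T → λ0 ≥ 0. Define V_T(U) := −log det(Ω0 + U/√T) + tr((Ω0 + U/√T)·Σ̂_T) + λ_T·‖Ω0 + U/√T‖²_{1,2} + log det Ω0 − tr(Ω0·Σ̂_T) − λ_T·‖Ω0‖²_{1,2}. Then T·V_T(U) converges, as T → ∞, to (1/2)·tr(U Σ0 U Σ0) + tr(U W) + 2·λ0·Σ_{i=1}^p Σ_{j=1}^p g_{ij}·d_j. -/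

import Mathlib

open Filter

/-- The squared mixed L₁,₂ norm of a matrix: ∑_j (∑_i |A_{ij}|)². -/
def L12sq {m n : ℕ} (A : Matrix (Fin m) (Fin n) ℝ) : ℝ :=
  ∑ j, (∑ i, |A i j|) ^ 2

/-- g(a,u) = u·sign(a) if a ≠ 0, and |u| if a = 0. -/
noncomputable def gfun (a u : ℝ) : ℝ :=
  if a ≠ 0 then u * Real.sign a else |u|

/-- The right derivative at `0` of `t ↦ |a + t * u|` is `gfun a u`. -/
lemma hasDerivWithinAt_abs_add_mul (a u : ℝ) :
    HasDerivWithinAt (fun t : ℝ => |a + t * u|) (gfun a u) (Set.Ioi 0) 0 := by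
  by_cases ha : a = 0
  · have h : HasDerivWithinAt (fun t : ℝ => t * |u|) (gfun a u) (Set.Ioi 0) 0 := by
      simpa [gfun, ha] using ((hasDerivAt_id (0 : ℝ)).mul_const |u|).hasDerivWithinAt
    refine h.congr (fun t ht => ?_) (by simp [ha])
    rw [ha, zero_add, abs_mul, abs_of_pos ht]
  · have h1 : HasDerivAt (fun t : ℝ => a + t * u) u 0 := by
      simpa using ((hasDerivAt_id (0 : ℝ)).mul_const u).const_add a
    have h2 : a + 0 * u ≠ 0 := by simpa using ha
    have h3 := ((hasDerivAt_abs h2).comp (0 : ℝ) h1).hasDerivWithinAt (s := Set.Ioi 0)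
    refine h3.congr_deriv ?_
    rcases lt_or_gt_of_ne ha with h | h
    · simp [gfun, ha, Real.sign_of_neg h, sign_neg h]
    · simp [gfun, ha, Real.sign_of_pos h, sign_pos h]

/-- The right derivative at `0` of the squared mixed norm along the line `t ↦ A + t • U`. -/
lemma hasDerivWithinAt_L12sq_add_smul {m n : ℕ} (A U : Matrix (Fin m) (Fin n) ℝ) :
    HasDerivWithinAt (fun t : ℝ => L12sq (A + t • U))
      (∑ j, 2 * (∑ i, |A i j|) * ∑ i, gfun (A i j) (U i j)) (Set.Ioi 0) 0 := by
  unfold L12sq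
  refine HasDerivWithinAt.fun_sum fun j _ => ?_
  have h : HasDerivWithinAt (fun t : ℝ => ∑ i, |A i j + t * U i j|)
      (∑ i, gfun (A i j) (U i j)) (Set.Ioi 0) 0 :=
    HasDerivWithinAt.fun_sum fun i _ => hasDerivWithinAt_abs_add_mul _ _
  simpa using h.fun_pow 2

/-- Jacobi's formula at `0` along the line `t ↦ A + t • U`, for invertible `A`. -/
lemma hasDerivAt_det_add_smul_zero {n : Type*} [Fintype n] [DecidableEq n]
    (A U : Matrix n n ℝ) (hA : IsUnit A.det) :
    HasDerivAt (fun t : ℝ => (A + t • U).det) (A.det * (A⁻¹ * U).trace) 0 := by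
  have key (t : ℝ) : (A + t • U).det = A.det * (1 + t • (A⁻¹ * U)).det := by
    rw [← Matrix.det_mul, mul_add, mul_one, Matrix.mul_smul,
      Matrix.mul_nonsing_inv_cancel_left _ _ hA]
  simp_rw [key]
  refine HasDerivAt.const_mul _ ?_
  rw [funext fun t : ℝ => Matrix.det_one_add_smul t (A⁻¹ * U)]
  set q := (Matrix.det (1 + (Polynomial.X : Polynomial ℝ) •
    (A⁻¹ * U).map Polynomial.C)).divX.divX
  have h := (((hasDerivAt_id (0 : ℝ)).const_mul (A⁻¹ * U).trace).const_add 1).fun_add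
    ((q.hasDerivAt 0).fun_mul ((hasDerivAt_id (0 : ℝ)).fun_pow 2))
  simpa using h

/-- Jacobi's formula for `log det` along the line `t ↦ A + t • U`. -/
lemma hasDerivAt_log_det_add_smul {n : Type*} [Fintype n] [DecidableEq n]
    (A U : Matrix n n ℝ) (t : ℝ) (ht : (A + t • U).det ≠ 0) :
    HasDerivAt (fun s : ℝ => Real.log (A + s • U).det) ((A + t • U)⁻¹ * U).trace t := by
  have h := hasDerivAt_det_add_smul_zero (A + t • U) U ht.isUnit
  have h' : HasDerivAt (fun s : ℝ => (A + s • U).det)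
      ((A + t • U).det * ((A + t • U)⁻¹ * U).trace) t := by
    rw [← sub_self t] at h
    have hline (s : ℝ) : A + t • U + (s - t) • U = A + s • U := by
      rw [add_assoc, ← add_smul, add_sub_cancel]
    simpa only [hline] using h.comp_sub_const t t
  simpa [ht] using h'.log ht

/-- Second-order expansion of `log det` at an invertible matrix `A` in the direction `U`. -/
lemma tendsto_log_det_expansion {n : Type*} [Fintype n] [DecidableEq n]
    (A U : Matrix n n ℝ) (hA : A.det ≠ 0) :
    Tendsto
      (fun t : ℝ => (Real.log A.det - Real.log (A + t • U).det + t * (A⁻¹ * U).trace) / t ^ 2)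
      (nhdsWithin 0 {0}ᶜ) (nhds (1 / 2 * (U * A⁻¹ * U * A⁻¹).trace)) := by
  have hcont : Continuous fun t : ℝ => A + t • U := by fun_prop
  have hdet : ∀ᶠ t in nhds (0 : ℝ), (A + t • U).det ≠ 0 :=
    hcont.matrix_det.continuousAt.eventually_ne (by simpa using hA)
  have hinv : ContinuousAt (fun t : ℝ => (A + t • U)⁻¹) 0 := by
    simp only [Matrix.inv_def, Ring.inverse_eq_inv']
    exact (hcont.matrix_det.continuousAt.inv₀ (by simpa using hA)).smul
      hcont.matrix_adjugate.continuousAt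
  have hlim : Tendsto (fun t : ℝ => 1 / 2 * ((A + t • U)⁻¹ * U * A⁻¹ * U).trace)
      (nhdsWithin 0 {0}ᶜ) (nhds (1 / 2 * (U * A⁻¹ * U * A⁻¹).trace)) := by
    have h : ContinuousAt (fun t : ℝ => 1 / 2 * ((A + t • U)⁻¹ * U * A⁻¹ * U).trace) 0 := by
      have htr : Continuous fun B : Matrix n n ℝ => 1 / 2 * (B * U * A⁻¹ * U).trace := by fun_prop
      exact htr.continuousAt.comp hinv
    have h0 : (A⁻¹ * U * A⁻¹ * U).trace = (U * A⁻¹ * U * A⁻¹).trace := by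
      rw [Matrix.mul_assoc, Matrix.mul_assoc, Matrix.trace_mul_comm]
      simp only [Matrix.mul_assoc]
    have := h.tendsto.mono_left (nhdsWithin_le_nhds (s := {0}ᶜ))
    simpa [h0] using this
  refine HasDerivAt.lhopital_zero_nhdsNE
    (f' := fun t => -((A + t • U)⁻¹ * U).trace + (A⁻¹ * U).trace) (g' := fun t => 2 * t)
    ?_ ?_ ?_ ?_ ?_ ?_
  · filter_upwards [hdet.filter_mono nhdsWithin_le_nhds] with t ht
    simpa using ((hasDerivAt_log_det_add_smul A U t ht).const_sub (Real.log A.det)).fun_add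
      ((hasDerivAt_id t).mul_const (A⁻¹ * U).trace)
  · filter_upwards with t
    simpa using hasDerivAt_pow 2 t
  · filter_upwards [self_mem_nhdsWithin] with t ht
    simpa using ht
  · have h := ((hasDerivAt_log_det_add_smul A U 0 (by simpa using hA)).const_sub
      (Real.log A.det)).fun_add ((hasDerivAt_id (0 : ℝ)).mul_const (A⁻¹ * U).trace)
    simpa using h.continuousAt.tendsto.mono_left (nhdsWithin_le_nhds (s := {0}ᶜ))
  · have h : ContinuousAt (fun t : ℝ => t ^ 2) 0 := by fun_prop
    simpa using h.tendsto.mono_left (nhdsWithin_le_nhds (s := {0}ᶜ))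
  · refine hlim.congr' ?_
    filter_upwards [hdet.filter_mono nhdsWithin_le_nhds, self_mem_nhdsWithin] with t ht ht0
    have ht0' : t ≠ 0 := ht0
    have hres : A⁻¹ - (A + t • U)⁻¹ = t • ((A + t • U)⁻¹ * U * A⁻¹) := by
      have h1 : (A + t • U)⁻¹ * ((A + t • U) - A) * A⁻¹ = A⁻¹ - (A + t • U)⁻¹ := by
        rw [mul_sub, sub_mul, Matrix.nonsing_inv_mul _ ht.isUnit, one_mul, Matrix.mul_assoc,
          Matrix.mul_nonsing_inv _ hA.isUnit, mul_one]
      rw [← h1, add_sub_cancel_left, Matrix.mul_smul, Matrix.smul_mul]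
    have htr : -((A + t • U)⁻¹ * U).trace + (A⁻¹ * U).trace
        = t * ((A + t • U)⁻¹ * U * A⁻¹ * U).trace := by
      rw [neg_add_eq_sub, ← Matrix.trace_sub, ← sub_mul, hres, Matrix.smul_mul, Matrix.trace_smul,
        smul_eq_mul]
    rw [htr]
    field_simp

/-- limit of the rescaled SGLASSO criterion T·V_T(U). -/
theorem sglasso_criterion_limit (p : ℕ)
    (Ω0 Sigma0 U W : Matrix (Fin p) (Fin p) ℝ)
    (hΩ0 : Ω0.PosDef) (hSigma0 : Sigma0 = Ω0⁻¹)
    (hU : ∀ i j, U i j = U j i)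
    (d : Fin p → ℝ) (hd : ∀ j, d j = ∑ k, |Ω0 j k|)
    (Sig : ℕ → Matrix (Fin p) (Fin p) ℝ)
    (hSig : ∀ i j, Tendsto (fun T : ℕ => Real.sqrt T * (Sig T i j - Sigma0 i j))
      atTop (nhds (W i j)))
    (lam : ℕ → ℝ) (lam0 : ℝ) (hlam0 : 0 ≤ lam0)
    (hlam : Tendsto (fun T : ℕ => Real.sqrt T * lam T) atTop (nhds lam0)) :
    Tendsto
      (fun T : ℕ =>
        (T : ℝ) *
          (-Real.log (Ω0 + (Real.sqrt T)⁻¹ • U).det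
            + Matrix.trace ((Ω0 + (Real.sqrt T)⁻¹ • U) * Sig T)
            + lam T * L12sq (Ω0 + (Real.sqrt T)⁻¹ • U)
            + Real.log Ω0.det
            - Matrix.trace (Ω0 * Sig T)
            - lam T * L12sq Ω0))
      atTop
      (nhds (1 / 2 * Matrix.trace (U * Sigma0 * U * Sigma0) + Matrix.trace (U * W)
        + 2 * lam0 * ∑ i, ∑ j, gfun (Ω0 i j) (U i j) * d j)) := by
  subst hSigma0
  have hs : Tendsto (fun T : ℕ => Real.sqrt T) atTop atTop :=
    Real.tendsto_sqrt_atTop.comp tendsto_natCast_atTop_atTop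
  have ht : Tendsto (fun T : ℕ => (Real.sqrt T)⁻¹) atTop (nhdsWithin 0 (Set.Ioi 0)) :=
    tendsto_inv_atTop_nhdsGT_zero.comp hs
  have hlog := (tendsto_log_det_expansion Ω0 U hΩ0.det_pos.ne').comp
    (ht.mono_right (nhdsWithin_mono 0 fun x (hx : 0 < x) => hx.ne'))
  have htrace : Tendsto (fun T : ℕ => (U * Matrix.of fun i j =>
      Real.sqrt T * (Sig T i j - Ω0⁻¹ i j)).trace) atTop (nhds (U * W).trace) := by
    simp only [Matrix.trace, Matrix.diag, Matrix.mul_apply, Matrix.of_apply]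
    exact tendsto_finsetSum _ fun i _ => tendsto_finsetSum _ fun j _ => (hSig j i).const_mul _
  have hpen := hlam.mul (((hasDerivWithinAt_iff_tendsto_slope' Set.self_notMem_Ioi).1
    (hasDerivWithinAt_L12sq_add_smul Ω0 U)).comp ht)
  have hsum : lam0 * ∑ j, 2 * (∑ i, |Ω0 i j|) * ∑ i, gfun (Ω0 i j) (U i j)
      = 2 * lam0 * ∑ i, ∑ j, gfun (Ω0 i j) (U i j) * d j := by
    have hdcol (j : Fin p) : ∑ i, |Ω0 i j| = d j := by
      rw [hd]
      exact Finset.sum_congr rfl fun i _ => by rw [← hΩ0.isHermitian.apply i j]; simp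
    rw [Finset.sum_comm, Finset.mul_sum, Finset.mul_sum]
    refine Finset.sum_congr rfl fun j _ => ?_
    rw [hdcol, ← Finset.sum_mul]
    ring
  rw [hsum] at hpen
  refine ((hlog.add htrace).add hpen).congr' ?_
  filter_upwards [hs.eventually_gt_atTop 0] with T hT
  have hscale : (Matrix.of fun i j => Real.sqrt T * (Sig T i j - Ω0⁻¹ i j))
      = Real.sqrt T • (Sig T - Ω0⁻¹) := by
    ext i j; simp
  have hTs : (T : ℝ) = Real.sqrt T ^ 2 := (Real.sq_sqrt (Nat.cast_nonneg T)).symm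
  rw [hscale]
  simp only [Function.comp_apply, slope_def_field, add_mul, Matrix.trace_add,
    Matrix.smul_mul, Matrix.mul_smul, Matrix.trace_smul, smul_eq_mul, mul_sub, Matrix.trace_sub,
    Matrix.trace_mul_comm Ω0⁻¹ U, zero_smul, add_zero, sub_zero]
  rw [hTs, Real.sqrt_sq hT.le]
  field_simp
  ring
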